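/- (Interference Decomposition Bound) Consider the k-user MISO BC with hybrid CSIT and any fixed linear coding strategy of block length n with precoding matrices V_1^n,…,V_k^n. For any subset S ⊆ {1,…,k}, any ℓ ∈ S, and any j ∉ S with CSIT state I_j = D, almost surely ( rank[G_ℓ^n[∪_{i∈S}V_i^n]] − rank[G_ℓ^n[∪_{i∈S, i≠ℓ}V_i^n]] + rank[G_j^n[∪_{i∈S, i≠ℓ}V_i^n]] ) / 2 ≤ rank[G_j^n[∪_{i∈S}V_i^n]]. -/

import Mathlib

open MeasureTheory Matrix Filter Topology

noncomputable section

/-- CSIT state of a receiver: instantaneous (`P`), delayed (`D`), or none (`N`). -/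
inductive CSITState : Type
  | P : CSITState
  | D : CSITState
  | N : CSITState
  deriving DecidableEq

/-- A channel realization: for each receiver `j`, time slot `t` and transmit antenna `a`,
the channel coefficient `g j t a`. -/
abbrev Chan (k m n : ℕ) : Type := Fin k → Fin n → Fin m → ℂ

/-- Joint law of the channel coefficients: all entries i.i.d. with common law `μ`. -/
def chanMeasure (k m n : ℕ) (μ : Measure ℂ) : Measure (Chan k m n) :=
  Measure.pi fun _ : Fin k => Measure.pi fun _ : Fin n => Measure.pi fun _ : Fin m => μ

/-- The block-diagonal channel matrix `G_j^n ∈ ℂ^{n × nm}` of a receiver with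
channel vectors `g (t) ∈ ℂ^{1 × m}`. -/
def blockDiag {m n : ℕ} (g : Fin n → Fin m → ℂ) : Matrix (Fin n) (Fin n × Fin m) ℂ :=
  Matrix.of fun t p => if p.1 = t then g t p.2 else 0

/-- A linear coding strategy of block length `n` for the `k`-user MISO BC with `m`
transmit antennas and hybrid CSIT configuration `I`. -/
structure Strategy (k m n : ℕ) (I : Fin k → CSITState) : Type where
  /-- number of information symbols `m_j(n)` for receiver `j` -/
  dim : Fin k → ℕ
  /-- precoding matrix `V_j(t) ∈ ℂ^{m × m_j(n)}`, a function of the channel realization -/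
  pre : (j : Fin k) → Fin n → Chan k m n → Matrix (Fin m) (Fin (dim j)) ℂ
  /-- each precoder is a measurable function of the channels -/
  meas : ∀ j t a c, Measurable fun g => pre j t g a c
  /-- `V_j(t)` depends only on the CSIT available at time `t`: current and past channels of
  receivers with instantaneous CSIT, and strictly past channels of receivers with delayed
  CSIT (and nothing from receivers with no CSIT). -/
  causal : ∀ (j : Fin k) (t : Fin n) (g g' : Chan k m n),
    (∀ i, I i = CSITState.P → ∀ s : Fin n, (s : ℕ) ≤ (t : ℕ) → g i s = g' i s) →
    (∀ i, I i = CSITState.D → ∀ s : Fin n, (s : ℕ) < (t : ℕ) → g i s = g' i s) →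
    pre j t g = pre j t g'

namespace Strategy

variable {k m n : ℕ} {I : Fin k → CSITState}

/-- The overall precoding matrix `V_j^n ∈ ℂ^{nm × m_j(n)}` (vertical concatenation of the
`V_j(t)`). -/
def Vn (f : Strategy k m n I) (j : Fin k) (g : Chan k m n) :
    Matrix (Fin n × Fin m) (Fin (f.dim j)) ℂ :=
  Matrix.of fun r c => f.pre j r.1 g r.2 c

/-- Horizontal concatenation `[∪_{i ∈ S} V_i^n]` of the precoding matrices of the
receivers in `S`. -/
def VS (f : Strategy k m n I) (S : Finset (Fin k)) (g : Chan k m n) :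
    Matrix (Fin n × Fin m) ((i : {x // x ∈ S}) × Fin (f.dim i.1)) ℂ :=
  Matrix.of fun r c => f.Vn c.1.1 g r c.2

/-- The received-signal matrix `G_j^n [∪_{i ∈ S} V_i^n]` at receiver `j`. -/
def recvS (f : Strategy k m n I) (S : Finset (Fin k)) (j : Fin k) (g : Chan k m n) :
    Matrix (Fin n) ((i : {x // x ∈ S}) × Fin (f.dim i.1)) ℂ :=
  blockDiag (g j) * f.VS S g

/-- The received-signal matrix `G_j^n V_j^n` at receiver `j` from its own precoder. -/
def recv1 (f : Strategy k m n I) (j : Fin k) (g : Chan k m n) :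
    Matrix (Fin n) (Fin (f.dim j)) ℂ :=
  blockDiag (g j) * f.Vn j g

/-- `G_j^t [∪_{i ∈ S} V_i^t]`: the received signal matrix restricted to the first `t`
time slots (rows beyond `t` set to zero, so that its rank is that of the truncated
matrix, with the `t = 0` convention of rank `0`). -/
def recvUpTo (f : Strategy k m n I) (S : Finset (Fin k)) (j : Fin k)
    (g : Chan k m n) (t : ℕ) :
    Matrix (Fin n) ((i : {x // x ∈ S}) × Fin (f.dim i.1)) ℂ :=
  Matrix.of fun s c => if (s : ℕ) < t then f.recvS S j g s c else 0

/-- Decodability: for every receiver `j`, almost surely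
`rank[G_j^n[∪_i V_i^n]] − rank[G_j^n[∪_{i ≠ j} V_i^n]] = rank[G_j^n V_j^n] = m_j(n)`. -/
def Decodable (f : Strategy k m n I) (μ : Measure ℂ) : Prop :=
  ∀ j : Fin k, ∀ᵐ g ∂ chanMeasure k m n μ,
    (f.recvS Finset.univ j g).rank - (f.recvS (Finset.univ.erase j) j g).rank
        = (f.recv1 j g).rank ∧
    (f.recv1 j g).rank = f.dim j

end Strategy

/-- A DoF tuple is linearly achievable if there is a sequence of decodable strategies
achieving it in the limit. -/
def LinAchievable (k m : ℕ) (I : Fin k → CSITState) (μ : Measure ℂ) (d : Fin k → ℝ) : Prop :=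
  (∀ j, 0 ≤ d j ∧ d j ≤ 1) ∧
  ∃ F : (n : ℕ) → Strategy k m n I,
    (∀ n, (F n).Decodable μ) ∧
    ∀ j, Tendsto (fun n : ℕ => ((F n).dim j : ℝ) / n) atTop (nhds (d j))

/-- The linear degrees-of-freedom region: closure of the set of linearly achievable tuples. -/
def LDoFRegion (k m : ℕ) (I : Fin k → CSITState) (μ : Measure ℂ) : Set (Fin k → ℝ) :=
  closure {d | LinAchievable k m I μ d}

/-- The linear sum degrees of freedom. -/
def LDoFSum (k m : ℕ) (I : Fin k → CSITState) (μ : Measure ℂ) : ℝ :=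
  sSup ((fun d => ∑ j, d j) '' LDoFRegion k m I μ)

/-- The set `𝒫` of receivers supplying instantaneous CSIT. -/
def stateP (k : ℕ) (I : Fin k → CSITState) : Finset (Fin k) :=
  Finset.univ.filter fun i => I i = CSITState.P

/-- The set `𝒟` of receivers supplying delayed CSIT. -/
def stateD (k : ℕ) (I : Fin k → CSITState) : Finset (Fin k) :=
  Finset.univ.filter fun i => I i = CSITState.D

/-- The set `𝒩` of receivers supplying no CSIT. -/
def stateN (k : ℕ) (I : Fin k → CSITState) : Finset (Fin k) :=
  Finset.univ.filter fun i => I i = CSITState.N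


/-- A measurable set in a finite product whose sections along one coordinate are all null
is null. -/
theorem measure_pi_eq_zero_of_section {ι : Type*} [Fintype ι] [DecidableEq ι] {X : ι → Type*}
    [∀ i, MeasurableSpace (X i)] (ν : ∀ i, Measure (X i)) [∀ i, SigmaFinite (ν i)]
    {E : Set (∀ i, X i)} (hE : MeasurableSet E) (i : ι)
    (h : ∀ x, ν i {y | Function.update x i y ∈ E} = 0) : Measure.pi ν E = 0 := by
  rcases E.eq_empty_or_nonempty with rfl | ⟨x₀, -⟩
  · simp
  have hf : Measurable (E.indicator (1 : (∀ i, X i) → ENNReal)) := measurable_one.indicator hE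
  rw [← lintegral_indicator_one hE, lintegral_eq_lmarginal_univ x₀,
    lmarginal_erase' _ hf (Finset.mem_univ i)]
  have h0 : (fun x => ∫⁻ y, E.indicator (1 : (∀ i, X i) → ENNReal) (Function.update x i y) ∂ν i)
      = fun _ => 0 := by
    funext x
    have hm : MeasurableSet {y | Function.update x i y ∈ E} := (measurable_update x) hE
    rw [← h x, ← lintegral_indicator_one hm]
    rfl
  rw [h0]
  simp [lmarginal]

theorem measurableSet_mem_span_range {α ι κ : Type*} [MeasurableSpace α] [Fintype ι] [Fintype κ]
    {u : ι → α → κ → ℂ} {w : α → κ → ℂ} (hu : ∀ i, Measurable (u i)) (hw : Measurable w) :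
    MeasurableSet {x | w x ∈ Submodule.span ℂ (Set.range fun i => u i x)} := by
  have key : {x | w x ∈ Submodule.span ℂ (Set.range fun i => u i x)} =
      ⋂ N : ℕ, ⋃ q : ℕ, {x | ‖w x - ∑ i, TopologicalSpace.denseSeq (ι → ℂ) q i • u i x‖
        < 1 / ((N : ℝ) + 1)} := by
    ext x
    simp only [Set.mem_ofPred_eq, Set.mem_iInter, Set.mem_iUnion]
    constructor
    · intro hx N
      obtain ⟨c, hc⟩ := (Submodule.mem_span_range_iff_exists_fun ℂ).1 hx
      have hopen : IsOpen {d : ι → ℂ | ‖w x - ∑ i, d i • u i x‖ < 1 / ((N : ℝ) + 1)} :=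
        isOpen_lt (by fun_prop) continuous_const
      obtain ⟨q, hq⟩ := (TopologicalSpace.denseRange_denseSeq (ι → ℂ)).exists_mem_open hopen
        ⟨c, by simp only [Set.mem_ofPred_eq, hc, sub_self, norm_zero]; positivity⟩
      exact ⟨q, hq⟩
    · intro hx
      have hcl : IsClosed (Submodule.span ℂ (Set.range fun i => u i x) : Set (κ → ℂ)) :=
        Submodule.closed_of_finiteDimensional _
      change w x ∈ (Submodule.span ℂ (Set.range fun i => u i x) : Set (κ → ℂ))
      rw [← hcl.closure_eq, Metric.mem_closure_iff]
      intro ε hε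
      obtain ⟨N, hN⟩ := exists_nat_one_div_lt hε
      obtain ⟨q, hq⟩ := hx N
      refine ⟨∑ i, TopologicalSpace.denseSeq (ι → ℂ) q i • u i x,
        (Submodule.mem_span_range_iff_exists_fun ℂ).2 ⟨_, rfl⟩, ?_⟩
      rw [dist_eq_norm]
      exact hq.trans hN
  rw [key]
  refine MeasurableSet.iInter fun N => MeasurableSet.iUnion fun q => ?_
  exact measurableSet_lt (by fun_prop) measurable_const

theorem finrank_add_finrank_map_le {K V V' : Type*} [Field K] [AddCommGroup V] [Module K V]
    [AddCommGroup V'] [Module K V'] [FiniteDimensional K V] (p : V →ₗ[K] V')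
    {L W : Submodule K V} (hLW : L ≤ W) :
    Module.finrank K L + Module.finrank K (W.map p) ≤
      Module.finrank K (L.map p) + Module.finrank K W := by
  obtain ⟨C, hC⟩ := exists_isCompl L
  have hsup : L ⊔ C ⊓ W = W := by
    rw [← sup_inf_assoc_of_le C hLW, hC.sup_eq_top, top_inf_eq]
  have hinf : L ⊓ (C ⊓ W) = ⊥ := by
    rw [← inf_assoc, hC.inf_eq_bot, bot_inf_eq]
  have h1 := Submodule.finrank_sup_add_finrank_inf_eq L (C ⊓ W)
  have h2 := Submodule.finrank_add_le_finrank_add_finrank (L.map p) ((C ⊓ W).map p)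
  have h3 := Submodule.finrank_map_le p (C ⊓ W)
  rw [hsup, hinf, finrank_bot] at h1
  rw [← Submodule.map_sup, hsup] at h2
  omega

/-- If `v t` lies in the span of the earlier `u s` whenever `u t` does, then adjoining the `v t`
to the span of the `u t` at most doubles its dimension. -/
theorem finrank_span_sup_le_two_mul {K V : Type*} [Field K] [AddCommGroup V] [Module K V]
    [FiniteDimensional K V] {n : ℕ} (u v : Fin n → V)
    (h : ∀ t, u t ∈ Submodule.span K (u '' Set.Iio t) → v t ∈ Submodule.span K (u '' Set.Iio t)) :
    Module.finrank K (Submodule.span K (Set.range v) ⊔ Submodule.span K (Set.range u) :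
      Submodule K V) ≤ 2 * Module.finrank K (Submodule.span K (Set.range u)) := by
  have key : ∀ T : ℕ, T ≤ n →
      Module.finrank K (Submodule.span K (v '' {s | (s : ℕ) < T}) ⊔
        Submodule.span K (u '' {s | (s : ℕ) < T}) : Submodule K V) ≤
      2 * Module.finrank K (Submodule.span K (u '' {s : Fin n | (s : ℕ) < T})) := by
    intro T
    induction T with
    | zero =>
      have hempty : {s : Fin n | (s : ℕ) < 0} = ∅ := by
        ext s
        simp
      rw [hempty, Set.image_empty, Set.image_empty, Submodule.span_empty, bot_sup_eq, finrank_bot]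
      exact fun _ => le_rfl
    | succ T ih =>
      intro hT
      have ih := ih (by omega)
      let t : Fin n := ⟨T, hT⟩
      have hset : {s : Fin n | (s : ℕ) < T + 1} = insert t {s : Fin n | (s : ℕ) < T} := by
        ext s
        simp only [Set.mem_ofPred_eq, Set.mem_insert_iff, Fin.ext_iff, t]
        omega
      have hIio : Set.Iio t = {s : Fin n | (s : ℕ) < T} := rfl
      have ht := h t
      rw [hIio] at ht
      rw [hset, Set.image_insert_eq, Set.image_insert_eq, Submodule.span_insert,
        Submodule.span_insert]
      set A := Submodule.span K (u '' {s : Fin n | (s : ℕ) < T})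
      set B := Submodule.span K (v '' {s : Fin n | (s : ℕ) < T})
      by_cases hu : u t ∈ A
      · have hv := ht hu
        rw [sup_eq_right.2 ((Submodule.span_singleton_le_iff_mem _ _).2 hu),
          sup_assoc, sup_eq_right.2 (((Submodule.span_singleton_le_iff_mem _ _).2 hv).trans
            le_sup_right)]
        exact ih
      · have hlt : Module.finrank K A < Module.finrank K (Submodule.span K {u t} ⊔ A :
            Submodule K V) := by
          apply Submodule.finrank_lt_finrank_of_lt
          refine lt_of_le_of_ne le_sup_right fun he => hu ?_
          rw [he]
          exact Submodule.mem_sup_left (Submodule.mem_span_singleton_self _)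
        have h1 := Submodule.finrank_add_le_finrank_add_finrank
          (Submodule.span K {v t} ⊔ Submodule.span K {u t}) (B ⊔ A)
        have h2 := Submodule.finrank_add_le_finrank_add_finrank
          (Submodule.span K {v t}) (Submodule.span K {u t})
        have h3 := finrank_span_le_card (R := K) {v t}
        have h4 := finrank_span_le_card (R := K) {u t}
        simp only [Set.toFinset_singleton, Finset.card_singleton] at h3 h4
        rw [sup_sup_sup_comm]
        omega
  have huniv : {s : Fin n | (s : ℕ) < n} = Set.univ := by
    ext s
    simp
  have hn := key n le_rfl
  rw [huniv, Set.image_univ, Set.image_univ] at hn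
  exact hn

namespace Strategy

variable {k m n : ℕ} {I : Fin k → CSITState}

/-- Row `a` of the concatenated precoding matrix `[∪_{i ∈ S} V_i(t)]` at time `t`. -/
def preRow (f : Strategy k m n I) (S : Finset (Fin k)) (t : Fin n) (a : Fin m)
    (g : Chan k m n) : ((i : {x // x ∈ S}) × Fin (f.dim i.1)) → ℂ :=
  fun c => f.pre c.1.1 t g a c.2

theorem recvS_row (f : Strategy k m n I) (S : Finset (Fin k)) (j : Fin k) (t : Fin n)
    (g : Chan k m n) : (f.recvS S j g).row t = ∑ a, g j t a • f.preRow S t a g := by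
  ext c
  simp [recvS, Matrix.row, Matrix.mul_apply, _root_.blockDiag, VS, Vn, preRow, Fintype.sum_prod_type,
    ite_mul]

theorem measurable_preRow (f : Strategy k m n I) (S : Finset (Fin k)) (t : Fin n) (a : Fin m) :
    Measurable (f.preRow S t a) :=
  measurable_pi_lambda _ fun c => f.meas c.1.1 t a c.2

theorem measurable_recvS_row (f : Strategy k m n I) (S : Finset (Fin k)) (j : Fin k)
    (t : Fin n) : Measurable fun g => (f.recvS S j g).row t := by
  simp only [recvS_row]
  have := f.measurable_preRow S t
  fun_prop

/-- The span of the signals received by receiver `j` before time `t`. -/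
def pastSpan (f : Strategy k m n I) (S : Finset (Fin k)) (j : Fin k) (t : Fin n)
    (g : Chan k m n) : Submodule ℂ (((i : {x // x ∈ S}) × Fin (f.dim i.1)) → ℂ) :=
  Submodule.span ℂ ((f.recvS S j g).row '' Set.Iio t)

theorem measurableSet_mem_pastSpan (f : Strategy k m n I) (S : Finset (Fin k)) (j : Fin k)
    (t : Fin n) {w : Chan k m n → ((i : {x // x ∈ S}) × Fin (f.dim i.1)) → ℂ}
    (hw : Measurable w) : MeasurableSet {g | w g ∈ f.pastSpan S j t g} := by
  have := measurableSet_mem_span_range (u := fun (s : Set.Iio t) g => (f.recvS S j g).row s)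
    (fun s => f.measurable_recvS_row S j s) hw
  simpa only [pastSpan, Set.image_eq_range] using this

/-- The channel realization `g` with the coefficient at `(j, t, a)` replaced by `y`. -/
def updateChan (g : Chan k m n) (j : Fin k) (t : Fin n) (a : Fin m) (y : ℂ) : Chan k m n :=
  Function.update g j (Function.update (g j) t (Function.update (g j t) a y))

theorem updateChan_of_ne_receiver (g : Chan k m n) {j i : Fin k} (t : Fin n) (a : Fin m) (y : ℂ)
    (hi : i ≠ j) : updateChan g j t a y i = g i := by
  simp [updateChan, hi]

theorem updateChan_of_ne_time (g : Chan k m n) (j i : Fin k) {t s : Fin n} (a : Fin m) (y : ℂ)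
    (hs : s ≠ t) : updateChan g j t a y i s = g i s := by
  by_cases hi : i = j
  · subst hi
    simp [updateChan, hs]
  · rw [updateChan_of_ne_receiver g t a y hi]

theorem updateChan_same (g : Chan k m n) (j : Fin k) (t : Fin n) (a : Fin m) (y : ℂ) :
    updateChan g j t a y j t = Function.update (g j t) a y := by
  simp [updateChan]

theorem chanMeasure_eq_zero_of_subsingleton (μ : Measure ℂ) [IsProbabilityMeasure μ]
    (hac : μ ≪ (volume : Measure ℂ)) {E : Set (Chan k m n)} (hE : MeasurableSet E)
    (j : Fin k) (t : Fin n) (a : Fin m)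
    (h : ∀ g, {y | updateChan g j t a y ∈ E}.Subsingleton) : chanMeasure k m n μ E = 0 := by
  refine measure_pi_eq_zero_of_section _ hE j fun g => ?_
  have hE₁ := measurable_update g (a := j) hE
  refine measure_pi_eq_zero_of_section _ hE₁ t fun x => ?_
  have hE₂ := measurable_update x (a := t) hE₁
  refine measure_pi_eq_zero_of_section _ hE₂ a fun z => hac ?_
  have := h (Function.update g j (Function.update x t z))
  simp only [updateChan, Function.update_self, Function.update_idem] at this
  exact this.measure_zero _

theorem preRow_updateChan (f : Strategy k m n I) (S : Finset (Fin k)) {j : Fin k}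
    (hjD : I j = CSITState.D) (g : Chan k m n) {s t : Fin n} (hst : s ≤ t) (a b : Fin m)
    (y : ℂ) :
    f.preRow S s b (updateChan g j t a y) = f.preRow S s b g := by
  funext c
  unfold preRow
  rw [f.causal c.1.1 s (updateChan g j t a y) g]
  · intro i hi s' _
    rw [updateChan_of_ne_receiver]
    rintro rfl
    simp [hi] at hjD
  · intro i _ s' hs'
    refine updateChan_of_ne_time g j i a y ?_
    rintro rfl
    exact absurd hs' (not_lt.2 hst)

theorem pastSpan_updateChan (f : Strategy k m n I) (S : Finset (Fin k)) {j : Fin k}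
    (hjD : I j = CSITState.D) (g : Chan k m n) (t : Fin n) (a : Fin m) (y : ℂ) :
    f.pastSpan S j t (updateChan g j t a y) = f.pastSpan S j t g := by
  unfold pastSpan
  congr 1
  refine Set.image_congr fun s hs => ?_
  rw [recvS_row, recvS_row, updateChan_of_ne_time g j j a y (ne_of_lt hs)]
  simp only [f.preRow_updateChan S hjD g (le_of_lt hs)]

/-- Almost surely, whenever the signal of a receiver with delayed CSIT lies in the span of its
past signals, so does every signal that was transmitted at that time. -/
theorem ae_preRow_mem_pastSpan (f : Strategy k m n I) (S : Finset (Fin k)) {j : Fin k}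
    (hjD : I j = CSITState.D) (μ : Measure ℂ) [IsProbabilityMeasure μ]
    (hac : μ ≪ (volume : Measure ℂ)) :
    ∀ᵐ g ∂ chanMeasure k m n μ, ∀ t, (f.recvS S j g).row t ∈ f.pastSpan S j t g →
      ∀ a, f.preRow S t a g ∈ f.pastSpan S j t g := by
  suffices h : ∀ t a, ∀ᵐ g ∂ chanMeasure k m n μ,
      ¬((f.recvS S j g).row t ∈ f.pastSpan S j t g ∧ f.preRow S t a g ∉ f.pastSpan S j t g) by
    filter_upwards [ae_all_iff.2 fun t => ae_all_iff.2 (h t)] with g hg t ht a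
    exact not_not.1 fun hn => hg t a ⟨ht, hn⟩
  intro t a
  rw [ae_iff]
  simp only [not_not]
  have hE := (f.measurableSet_mem_pastSpan S j t (f.measurable_recvS_row S j t)).inter
    (f.measurableSet_mem_pastSpan S j t (f.measurable_preRow S t a)).compl
  refine chanMeasure_eq_zero_of_subsingleton μ hac hE j t a fun g y hy z hz => ?_
  obtain ⟨hy, hn⟩ := hy
  obtain ⟨hz, -⟩ := hz
  simp only [recvS_row, f.pastSpan_updateChan S hjD,
    f.preRow_updateChan S hjD g le_rfl, updateChan_same] at hy hn hz
  by_contra hyz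
  have hsub := Submodule.sub_mem _ hy hz
  rw [← Finset.sum_sub_distrib, Finset.sum_eq_single a] at hsub
  · rw [← sub_smul, Function.update_self, Function.update_self] at hsub
    exact hn ((Submodule.smul_mem_iff _ (sub_ne_zero.2 hyz)).1 hsub)
  · intro b _ hb
    simp [hb]
  · simp

theorem rank_recvS (f : Strategy k m n I) (S : Finset (Fin k)) (i : Fin k) (g : Chan k m n) :
    (f.recvS S i g).rank = Module.finrank ℂ (Submodule.span ℂ (Set.range (f.recvS S i g).row)) :=
  Matrix.rank_eq_finrank_span_row _

theorem rank_recvS_of_subset (f : Strategy k m n I) {S S' : Finset (Fin k)} (h : S' ⊆ S)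
    (i : Fin k) (g : Chan k m n) :
    (f.recvS S' i g).rank = Module.finrank ℂ
      ((Submodule.span ℂ (Set.range (f.recvS S i g).row)).map
        (LinearMap.funLeft ℂ ℂ fun c : (i : {x // x ∈ S'}) × Fin (f.dim i.1) =>
          (⟨⟨c.1.1, h c.1.2⟩, c.2⟩ : (i : {x // x ∈ S}) × Fin (f.dim i.1)))) := by
  rw [rank_recvS, Submodule.map_span, ← Set.range_comp]
  rfl

end Strategy

/-- **Interference Decomposition Bound.** For any linear coding strategy, any `S`, any
`ℓ ∈ S` and any `j ∉ S` supplying delayed CSIT, almost surely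
`(rank[G_ℓ[∪_{i∈S}V_i]] − rank[G_ℓ[∪_{i∈S,i≠ℓ}V_i]] + rank[G_j[∪_{i∈S,i≠ℓ}V_i]])/2
  ≤ rank[G_j[∪_{i∈S}V_i]]`. -/
theorem interference_decomposition_bound (k m n : ℕ) (hkm : k ≤ m)
    (I : Fin k → CSITState) (μ : Measure ℂ) [IsProbabilityMeasure μ]
    (hac : μ ≪ (volume : Measure ℂ)) (f : Strategy k m n I)
    (S : Finset (Fin k)) (ℓ : Fin k) (hℓ : ℓ ∈ S)
    (j : Fin k) (hj : j ∉ S) (hjD : I j = CSITState.D) :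
    ∀ᵐ g ∂ chanMeasure k m n μ,
      (((f.recvS S ℓ g).rank : ℝ) - ((f.recvS (S.erase ℓ) ℓ g).rank : ℝ)
          + ((f.recvS (S.erase ℓ) j g).rank : ℝ)) / 2
        ≤ ((f.recvS S j g).rank : ℝ) := by
  filter_upwards [f.ae_preRow_mem_pastSpan S hjD μ hac] with g hg
  have hsub := Finset.erase_subset ℓ S
  have hdouble := finrank_span_sup_le_two_mul (K := ℂ) (f.recvS S j g).row (f.recvS S ℓ g).row
    fun t ht => by
      rw [f.recvS_row S ℓ t g]
      exact Submodule.sum_mem _ fun a _ => Submodule.smul_mem _ _ (hg t ht a)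
  set L := Submodule.span ℂ (Set.range (f.recvS S ℓ g).row) with hL
  set J := Submodule.span ℂ (Set.range (f.recvS S j g).row) with hJ
  rw [f.rank_recvS_of_subset hsub ℓ g, f.rank_recvS_of_subset hsub j g, f.rank_recvS S ℓ g,
    f.rank_recvS S j g, ← hL, ← hJ]
  set p := LinearMap.funLeft ℂ ℂ fun c : (i : {x // x ∈ S.erase ℓ}) × Fin (f.dim i.1) =>
    (⟨⟨c.1.1, hsub c.1.2⟩, c.2⟩ : (i : {x // x ∈ S}) × Fin (f.dim i.1))
  have hquot := finrank_add_finrank_map_le p (le_sup_left : L ≤ L ⊔ J)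
  have hmono := Submodule.finrank_mono (Submodule.map_mono (f := p) (le_sup_right : J ≤ L ⊔ J))
  have hnat : Module.finrank ℂ L + Module.finrank ℂ (J.map p) ≤
      Module.finrank ℂ (L.map p) + 2 * Module.finrank ℂ J := by omega
  have hreal : (Module.finrank ℂ L : ℝ) + Module.finrank ℂ (J.map p) ≤
      Module.finrank ℂ (L.map p) + 2 * Module.finrank ℂ J := by exact_mod_cast hnat
  linarith

end
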